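/- Let λ ∈ ℝ. Then the function k ↦ Θ(λK(k), k) is differentiable on (0,1) and its derivative with respect to the modulus k is d/dk { Θ(λK(k), k) } = −(1/(2k k'²)) · Θ(λK(k), k) · ( dn²(λK(k), k) + zn²(λK(k), k) − E(k)/K(k) ), where k' = √(1−k²); equivalently, d/dk { Θ(λK(k), k) } = −(1/(2k k'²)) · ∂²Θ(u,k)/∂u² evaluated at u = λK(k). -/

import Mathlib

open Real

/-- Complete elliptic integral of the first kind. -/
noncomputable def EllK (k : ℝ) : ℝ :=
  ∫ θ in (0:ℝ)..(π/2), 1 / Real.sqrt (1 - k^2 * Real.sin θ ^ 2)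

/-- Complete elliptic integral of the second kind. -/
noncomputable def EllE (k : ℝ) : ℝ :=
  ∫ θ in (0:ℝ)..(π/2), Real.sqrt (1 - k^2 * Real.sin θ ^ 2)

/-- Complementary complete elliptic integral `K'(k) = K(√(1-k²))`. -/
noncomputable def EllK' (k : ℝ) : ℝ := EllK (Real.sqrt (1 - k^2))

/-- Complementary elliptic integral of the second kind `E'(k) = E(√(1-k²))`. -/
noncomputable def EllE' (k : ℝ) : ℝ := EllE (Real.sqrt (1 - k^2))

/-- The nome `q = exp(-π K'(k)/K(k))`. -/
noncomputable def nome (k : ℝ) : ℝ := Real.exp (-π * EllK' k / EllK k)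

/-- Jacobi's theta function `Θ(u,k) = 1 + 2 ∑_{n≥1} (-1)^n q^{n²} cos(nπu/K)`. -/
noncomputable def JTheta (u k : ℝ) : ℝ :=
  1 + 2 * ∑' n : ℕ, (-1 : ℝ)^(n+1) * nome k ^ ((n+1)^2) *
    Real.cos (((n:ℝ)+1) * π * u / EllK k)

/-- Jacobi's theta function `H(u,k) = 2 ∑_{n≥0} (-1)^n q^{(n+1/2)²} sin((2n+1)πu/(2K))`. -/
noncomputable def JH (u k : ℝ) : ℝ :=
  2 * ∑' n : ℕ, (-1 : ℝ)^n * nome k ^ ((((n:ℝ) + 1/2)^2)) *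
    Real.sin ((2*(n:ℝ)+1) * π * u / (2 * EllK k))

/-- Jacobi's theta function `H₁(u,k) = 2 ∑_{n≥0} q^{(n+1/2)²} cos((2n+1)πu/(2K))`. -/
noncomputable def JH1 (u k : ℝ) : ℝ :=
  2 * ∑' n : ℕ, nome k ^ ((((n:ℝ) + 1/2)^2)) *
    Real.cos ((2*(n:ℝ)+1) * π * u / (2 * EllK k))

/-- Jacobi's theta function `Θ₁(u,k) = 1 + 2 ∑_{n≥1} q^{n²} cos(nπu/K)`. -/
noncomputable def JTheta1 (u k : ℝ) : ℝ :=
  1 + 2 * ∑' n : ℕ, nome k ^ ((n+1)^2) * Real.cos (((n:ℝ)+1) * π * u / EllK k)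

/-- Jacobi's zeta function `zn(u,k) = Θ_u(u,k)/Θ(u,k)`. -/
noncomputable def zn (u k : ℝ) : ℝ := deriv (fun v => JTheta v k) u / JTheta u k

/-- Jacobi's elliptic sine `sn(u,k) = H(u,k)/(√k Θ(u,k))`. -/
noncomputable def sn (u k : ℝ) : ℝ := JH u k / (Real.sqrt k * JTheta u k)

/-- Jacobi's elliptic cosine `cn(u,k) = √(k'/k) H₁(u,k)/Θ(u,k)`. -/
noncomputable def cn (u k : ℝ) : ℝ :=
  Real.sqrt (Real.sqrt (1 - k^2) / k) * JH1 u k / JTheta u k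

/-- Jacobi's delta amplitude `dn(u,k) = √(k') Θ₁(u,k)/Θ(u,k)`. -/
noncomputable def dn (u k : ℝ) : ℝ :=
  Real.sqrt (Real.sqrt (1 - k^2)) * JTheta1 u k / JTheta u k

lemma one_sub_sq_mul_sin_sq_pos {k : ℝ} (hk : k ^ 2 < 1) (θ : ℝ) :
    0 < 1 - k ^ 2 * Real.sin θ ^ 2 := by
  nlinarith [sin_sq_le_one θ, sq_nonneg k, sq_nonneg (Real.sin θ)]

lemma continuous_inv_sqrt_one_sub {k : ℝ} (hk : k ^ 2 < 1) :
    Continuous fun θ : ℝ => 1 / √(1 - k ^ 2 * Real.sin θ ^ 2) :=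
  continuous_const.div (by fun_prop) fun θ =>
    (Real.sqrt_pos.2 (one_sub_sq_mul_sin_sq_pos hk θ)).ne'

lemma EllK_zero : EllK 0 = π / 2 := by simp [EllK]

lemma EllK_pos {k : ℝ} (hk : k ^ 2 < 1) : 0 < EllK k :=
  intervalIntegral.intervalIntegral_pos_of_pos
    ((continuous_inv_sqrt_one_sub hk).intervalIntegrable _ _)
    (fun θ => one_div_pos.2 (Real.sqrt_pos.2 (one_sub_sq_mul_sin_sq_pos hk θ))) (by positivity)

/-- Landen's transformation of the complete elliptic integral of the first kind. -/
lemma EllK_landen {r : ℝ} (h0 : 0 ≤ r) (h1 : r < 1) :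
    EllK (2 * r / (1 + r ^ 2)) = (1 + r ^ 2) * EllK (r ^ 2) := by
  have hc1 : r ^ 2 < 1 := by nlinarith
  have hk : (2 * r / (1 + r ^ 2)) ^ 2 < 1 := by
    rw [div_pow, div_lt_one (by positivity)]
    nlinarith [sq_pos_of_pos (sub_pos.2 hc1)]
  have hcc : (r ^ 2) ^ 2 < 1 := by nlinarith [sq_nonneg r]
  have hS : ∀ x, 0 < 1 - (r ^ 2 * Real.sin x) ^ 2 := fun x => by
    have := one_sub_sq_mul_sin_sq_pos hcc x
    rwa [mul_pow]
  have hlt : ∀ x, |r ^ 2 * Real.sin x| < 1 := fun x => by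
    have := hS x
    rw [← sq_lt_one_iff_abs_lt_one]
    linarith
  have hφ : ∀ x ∈ Set.uIcc 0 π, HasDerivAt
      (fun x => (x + Real.arcsin (r ^ 2 * Real.sin x)) / 2)
      ((1 + 1 / √(1 - (r ^ 2 * Real.sin x) ^ 2) * (r ^ 2 * Real.cos x)) / 2) x := fun x _ => by
    have h := abs_lt.1 (hlt x)
    exact ((hasDerivAt_id x).add ((Real.hasDerivAt_arcsin h.1.ne' h.2.ne).comp x
      ((Real.hasDerivAt_sin x).const_mul (r ^ 2)))).div_const 2
  have hcont : ContinuousOn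
      (fun x => (1 + 1 / √(1 - (r ^ 2 * Real.sin x) ^ 2) * (r ^ 2 * Real.cos x)) / 2)
      (Set.uIcc 0 π) := by
    have : Continuous fun x => 1 / √(1 - (r ^ 2 * Real.sin x) ^ 2) :=
      continuous_const.div (by fun_prop) fun x => (Real.sqrt_pos.2 (hS x)).ne'
    fun_prop
  have hsub := intervalIntegral.integral_comp_mul_deriv hφ hcont (continuous_inv_sqrt_one_sub hk)
  have hpt : ∀ x : ℝ, ((fun θ : ℝ => 1 / √(1 - (2 * r / (1 + r ^ 2)) ^ 2 * Real.sin θ ^ 2)) ∘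
      fun x => (x + Real.arcsin (r ^ 2 * Real.sin x)) / 2) x *
      ((1 + 1 / √(1 - (r ^ 2 * Real.sin x) ^ 2) * (r ^ 2 * Real.cos x)) / 2) =
      (1 + r ^ 2) / 2 * (1 / √(1 - (r ^ 2) ^ 2 * Real.sin x ^ 2)) := fun x => by
    have hb := abs_lt.1 (hlt x)
    set β := Real.arcsin (r ^ 2 * Real.sin x) with hβ
    have hsβ : Real.sin β = r ^ 2 * Real.sin x := Real.sin_arcsin hb.1.le hb.2.le
    have hcβ : Real.cos β = √(1 - (r ^ 2 * Real.sin x) ^ 2) := Real.cos_arcsin _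
    have hcpos : 0 < Real.cos β := by rw [hcβ]; exact Real.sqrt_pos.2 (hS x)
    have hcsq : Real.cos β ^ 2 = 1 - (r ^ 2 * Real.sin x) ^ 2 := by
      rw [hcβ, Real.sq_sqrt (hS x).le]
    have hpos : 0 < Real.cos β + r ^ 2 * Real.cos x := by
      have : |r ^ 2 * Real.cos x| < Real.cos β := by
        apply abs_lt_of_sq_lt_sq _ hcpos.le
        rw [hcsq]
        nlinarith [Real.sin_sq_add_cos_sq x]
      linarith [neg_abs_le (r ^ 2 * Real.cos x)]
    have hsin : Real.sin ((x + β) / 2) ^ 2 =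
        (1 - (Real.cos x * Real.cos β - Real.sin x * (r ^ 2 * Real.sin x))) / 2 := by
      rw [← hsβ, ← Real.cos_add, Real.sin_sq_eq_half_sub, mul_div_cancel₀ _ two_ne_zero]
      ring
    have hΔ : √(1 - (2 * r / (1 + r ^ 2)) ^ 2 * Real.sin ((x + β) / 2) ^ 2) =
        (Real.cos β + r ^ 2 * Real.cos x) / (1 + r ^ 2) := by
      rw [Real.sqrt_eq_iff_mul_self_eq_of_pos (by positivity), hsin]
      field_simp
      have := Real.sin_sq_add_cos_sq x
      have h2 : Real.cos x ^ 2 = 1 - Real.sin x ^ 2 := by linarith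
      linear_combination hcsq + r ^ 4 * h2
    have hD : √(1 - (r ^ 2) ^ 2 * Real.sin x ^ 2) = Real.cos β := by rw [hcβ, mul_pow]
    simp only [Function.comp]
    rw [← hβ, hΔ, ← hcβ, hD]
    field_simp
  simp only [hpt] at hsub
  rw [intervalIntegral.integral_const_mul] at hsub
  simp only [Real.sin_zero, mul_zero, Real.arcsin_zero, add_zero, zero_div, Real.sin_pi] at hsub
  have hI := fun a b => (continuous_inv_sqrt_one_sub hcc).intervalIntegrable
    (μ := MeasureTheory.volume) a b
  have hrefl : ∫ x in (π / 2)..π, 1 / √(1 - (r ^ 2) ^ 2 * Real.sin x ^ 2) = EllK (r ^ 2) := by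
    have := intervalIntegral.integral_comp_sub_left (a := 0) (b := π / 2)
      (fun x => 1 / √(1 - (r ^ 2) ^ 2 * Real.sin x ^ 2)) π
    simp only [Real.sin_pi_sub, sub_zero] at this
    rw [EllK, this]
    congr 1
    ring
  rw [← intervalIntegral.integral_add_adjacent_intervals (hI 0 (π / 2)) (hI (π / 2) π), hrefl]
    at hsub
  change _ * (EllK _ + _) = EllK _ at hsub
  rw [← hsub]
  ring

lemma sqrt_one_sub_hasDerivAt {k : ℝ} (hk : k ^ 2 < 1) (θ : ℝ) :
    HasDerivAt (fun k => 1 / √(1 - k ^ 2 * Real.sin θ ^ 2))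
      (k * Real.sin θ ^ 2 / √(1 - k ^ 2 * Real.sin θ ^ 2) ^ 3) k := by
  have hp := one_sub_sq_mul_sin_sq_pos hk θ
  have hs := Real.sqrt_pos.2 hp
  have h1 : HasDerivAt (fun k => 1 - k ^ 2 * Real.sin θ ^ 2) (-(2 * k * Real.sin θ ^ 2)) k := by
    simpa using ((hasDerivAt_pow 2 k).mul_const (Real.sin θ ^ 2)).const_sub 1
  have h2 := (h1.sqrt hp.ne').inv hs.ne'
  simp only [one_div]
  refine h2.congr_deriv ?_
  field_simp

lemma integral_sqrt_one_sub_inv_cube {k : ℝ} (hk : k ^ 2 < 1) :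
    (1 - k ^ 2) * ∫ θ in (0:ℝ)..(π / 2), 1 / √(1 - k ^ 2 * Real.sin θ ^ 2) ^ 3 = EllE k := by
  have hpos := one_sub_sq_mul_sin_sq_pos hk
  have hcE : Continuous fun θ : ℝ => √(1 - k ^ 2 * Real.sin θ ^ 2) := by fun_prop
  have hcC : Continuous fun θ : ℝ => 1 / √(1 - k ^ 2 * Real.sin θ ^ 2) ^ 3 :=
    continuous_const.div (by fun_prop) fun θ => (pow_pos (Real.sqrt_pos.2 (hpos θ)) 3).ne'
  have hcC' : Continuous fun θ : ℝ => (1 - k ^ 2) * (1 / √(1 - k ^ 2 * Real.sin θ ^ 2) ^ 3) :=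
    continuous_const.mul hcC
  have hder : ∀ θ ∈ Set.uIcc 0 (π / 2), HasDerivAt
      (fun θ => k ^ 2 * (Real.sin θ * Real.cos θ) / √(1 - k ^ 2 * Real.sin θ ^ 2))
      (√(1 - k ^ 2 * Real.sin θ ^ 2) - (1 - k ^ 2) * (1 / √(1 - k ^ 2 * Real.sin θ ^ 2) ^ 3)) θ :=
    fun θ _ => by
    have hp := hpos θ
    have hs := Real.sqrt_pos.2 hp
    have h1 : HasDerivAt (fun θ => 1 - k ^ 2 * Real.sin θ ^ 2)
        (-(k ^ 2 * (2 * Real.sin θ * Real.cos θ))) θ := by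
      simpa using (((Real.hasDerivAt_sin θ).pow 2).const_mul (k ^ 2)).const_sub 1
    have h2 := ((((Real.hasDerivAt_sin θ).mul (Real.hasDerivAt_cos θ)).const_mul (k ^ 2)).div
      (h1.sqrt hp.ne') hs.ne')
    refine h2.congr_deriv ?_
    have hsq := Real.sq_sqrt hp.le
    set D := √(1 - k ^ 2 * Real.sin θ ^ 2)
    have hc : Real.cos θ ^ 2 = 1 - Real.sin θ ^ 2 := by
      linarith [Real.sin_sq_add_cos_sq θ]
    simp only [Pi.mul_apply]
    field_simp
    have h4 : D ^ 4 = (1 - k ^ 2 * Real.sin θ ^ 2) ^ 2 := by rw [← hsq]; ring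
    rw [h4, hsq, hc]
    ring
  have hftc := intervalIntegral.integral_eq_sub_of_hasDerivAt hder
    ((hcE.sub hcC').intervalIntegrable _ _)
  rw [intervalIntegral.integral_sub (hcE.intervalIntegrable _ _)
    (hcC'.intervalIntegrable _ _),
    intervalIntegral.integral_const_mul] at hftc
  simp at hftc
  simp only [EllE, one_div]
  linarith

lemma EllK_hasDerivAt_integral {k : ℝ} (hk : k ^ 2 < 1) :
    HasDerivAt EllK (∫ θ in (0:ℝ)..(π / 2),
      k * Real.sin θ ^ 2 / √(1 - k ^ 2 * Real.sin θ ^ 2) ^ 3) k := by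
  obtain ⟨c, hkc, hc1⟩ := exists_between hk
  have hcont : ∀ x : ℝ, x ^ 2 < 1 →
      Continuous fun θ => x * Real.sin θ ^ 2 / √(1 - x ^ 2 * Real.sin θ ^ 2) ^ 3 := fun x hx =>
    Continuous.div (by fun_prop) (by fun_prop)
      fun θ => (pow_pos (Real.sqrt_pos.2 (one_sub_sq_mul_sin_sq_pos hx θ)) 3).ne'
  have hs : {x : ℝ | x ^ 2 < c} ∈ nhds k :=
    (isOpen_lt (continuous_pow 2) continuous_const).mem_nhds hkc
  refine (intervalIntegral.hasDerivAt_integral_of_dominated_loc_of_deriv_le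
    (F := fun k θ => 1 / √(1 - k ^ 2 * Real.sin θ ^ 2))
    (F' := fun k θ => k * Real.sin θ ^ 2 / √(1 - k ^ 2 * Real.sin θ ^ 2) ^ 3)
    (bound := fun _ => 1 / √(1 - c) ^ 3) hs ?_ ?_ ?_ ?_ ?_ ?_).2
  · filter_upwards [hs] with x hx
    exact (continuous_inv_sqrt_one_sub (lt_trans hx hc1)).aestronglyMeasurable
  · exact (continuous_inv_sqrt_one_sub hk).intervalIntegrable _ _
  · exact (hcont k hk).aestronglyMeasurable
  · refine Filter.Eventually.of_forall fun θ _ x hx => ?_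
    have hx' : x ^ 2 < c := hx
    have h0 : 0 < √(1 - c) := Real.sqrt_pos.2 (by linarith)
    have hle : √(1 - c) ≤ √(1 - x ^ 2 * Real.sin θ ^ 2) :=
      Real.sqrt_le_sqrt (by nlinarith [Real.sin_sq_le_one θ, sq_nonneg x])
    rw [norm_div, norm_pow, Real.norm_of_nonneg (h0.le.trans hle), Real.norm_eq_abs, abs_mul,
      abs_of_nonneg (sq_nonneg (Real.sin θ))]
    have hx1 : |x| ≤ 1 := by
      rw [← sq_le_one_iff_abs_le_one]; linarith
    gcongr
    exact mul_le_one₀ hx1 (sq_nonneg _) (Real.sin_sq_le_one θ)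
  · exact intervalIntegrable_const
  · exact Filter.Eventually.of_forall fun θ _ x hx =>
      sqrt_one_sub_hasDerivAt (lt_trans hx hc1) θ

lemma EllK_continuousAt {k : ℝ} (hk : k ^ 2 < 1) : ContinuousAt EllK k :=
  (EllK_hasDerivAt_integral hk).continuousAt

lemma EllK_hasDerivAt {k : ℝ} (hk0 : k ≠ 0) (hk : k ^ 2 < 1) :
    HasDerivAt EllK ((EllE k - (1 - k ^ 2) * EllK k) / (k * (1 - k ^ 2))) k := by
  refine (EllK_hasDerivAt_integral hk).congr_deriv ?_
  have hpos := one_sub_sq_mul_sin_sq_pos hk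
  have hcC : Continuous fun θ : ℝ => 1 / √(1 - k ^ 2 * Real.sin θ ^ 2) ^ 3 :=
    continuous_const.div (by fun_prop) fun θ => (pow_pos (Real.sqrt_pos.2 (hpos θ)) 3).ne'
  have hpt : ∀ θ, k * Real.sin θ ^ 2 / √(1 - k ^ 2 * Real.sin θ ^ 2) ^ 3 =
      k⁻¹ * (1 / √(1 - k ^ 2 * Real.sin θ ^ 2) ^ 3 - 1 / √(1 - k ^ 2 * Real.sin θ ^ 2)) :=
    fun θ => by
    have hs := Real.sqrt_pos.2 (hpos θ)
    have hsq := Real.sq_sqrt (hpos θ).le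
    set D := √(1 - k ^ 2 * Real.sin θ ^ 2)
    field_simp
    rw [hsq]
    ring
  simp only [hpt]
  rw [intervalIntegral.integral_const_mul, intervalIntegral.integral_sub
    (hcC.intervalIntegrable _ _) ((continuous_inv_sqrt_one_sub hk).intervalIntegrable _ _),
    ← integral_sqrt_one_sub_inv_cube hk]
  have : 1 - k ^ 2 ≠ 0 := by linarith
  change k⁻¹ * (_ - EllK k) = _
  field_simp

section IntegerSums

lemma isCompl_range_add_sub : IsCompl (Set.range fun p : ℤ × ℤ => (p.1 + p.2, p.1 - p.2))
    (Set.range fun p : ℤ × ℤ => (p.1 + p.2 + 1, p.1 - p.2)) := by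
  refine IsCompl.of_eq (Set.disjoint_left.2 ?_).eq_bot (Set.eq_univ_of_forall ?_)
  · rintro _ ⟨⟨a, b⟩, rfl⟩ ⟨⟨c, d⟩, hq⟩
    simp only [Prod.mk.injEq] at hq
    omega
  · rintro ⟨m, n⟩
    rcases Int.even_or_odd' (m + n) with ⟨a, ha | ha⟩
    · refine Or.inl ⟨(a, m - a), ?_⟩
      simp only [Prod.mk.injEq]
      omega
    · refine Or.inr ⟨(a, m - a - 1), ?_⟩
      simp only [Prod.mk.injEq]
      omega

variable {R : Type*} [NormedCommRing R] [CompleteSpace R]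

lemma tsum_int_even_add_odd {f : ℤ → R} (hf : Summable f) :
    ∑' n : ℤ, f n = ∑' n : ℤ, f (2 * n) + ∑' n : ℤ, f (2 * n + 1) := by
  have h2 : Function.Injective fun n : ℤ => 2 * n := fun a b h => by simpa using h
  have h3 : Function.Injective fun n : ℤ => 2 * n + 1 := fun a b h => by simpa using h
  have hc : IsCompl (Set.range fun n : ℤ => 2 * n) (Set.range fun n : ℤ => 2 * n + 1) := by
    constructor
    · rw [Set.disjoint_left]
      rintro _ ⟨p, rfl⟩ ⟨q, hq⟩
      simp only at hq
      omega
    · rw [codisjoint_iff_le_sup]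
      rintro m -
      rcases Int.even_or_odd' m with ⟨a, ha | ha⟩
      · exact Or.inl ⟨a, ha.symm⟩
      · exact Or.inr ⟨a, ha.symm⟩
  exact ((h2.hasSum_range_iff.2 (hf.comp_injective h2).hasSum).add_isCompl hc
    (h3.hasSum_range_iff.2 (hf.comp_injective h3).hasSum)).tsum_eq

/-- Summation over `ℤ × ℤ` in the coordinates `m + n`, `m - n`, which have equal parity. -/
lemma hasSum_add_sub {f g : ℤ → R} (hf : Summable fun n => ‖f n‖) (hg : Summable fun n => ‖g n‖) :
    HasSum (fun p : ℤ × ℤ => f (p.1 + p.2) * g (p.1 - p.2))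
      ((∑' n, f (2 * n)) * (∑' n, g (2 * n)) +
        (∑' n, f n - ∑' n, f (2 * n)) * (∑' n, g n - ∑' n, g (2 * n))) := by
  have h2 : Function.Injective fun n : ℤ => 2 * n := fun a b h => by simpa using h
  have h3 : Function.Injective fun n : ℤ => 2 * n + 1 := fun a b h => by simpa using h
  have hi : Function.Injective fun p : ℤ × ℤ => (p.1 + p.2, p.1 - p.2) := fun ⟨a, b⟩ ⟨c, d⟩ h => by
    simp only [Prod.mk.injEq] at h ⊢
    omega
  have hj : Function.Injective fun p : ℤ × ℤ => (p.1 + p.2 + 1, p.1 - p.2) :=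
    fun ⟨a, b⟩ ⟨c, d⟩ h => by
    simp only [Prod.mk.injEq] at h ⊢
    omega
  have hodd : ∀ h : ℤ → R, Summable (fun n => ‖h n‖) →
      ∑' n, h n - ∑' n, h (2 * n) = ∑' n, h (2 * n + 1) := fun h hh => by
    rw [tsum_int_even_add_odd hh.of_norm]; ring
  rw [hodd f hf, hodd g hg]
  have hprod : ∀ u v : ℤ → R, Summable (fun n => ‖u n‖) → Summable (fun n => ‖v n‖) →
      HasSum (fun p : ℤ × ℤ => u p.1 * v p.2) ((∑' n, u n) * ∑' n, v n) := fun u v hu hv => by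
    rw [tsum_mul_tsum_of_summable_norm hu hv]
    exact (summable_mul_of_summable_norm hu hv).hasSum
  have he := hprod (fun n => f (2 * n)) (fun n => g (2 * n)) (hf.comp_injective h2)
    (hg.comp_injective h2)
  have ho := hprod (fun n => f (2 * n + 1)) (fun n => g (2 * n + 1)) (hf.comp_injective h3)
    (hg.comp_injective h3)
  set F : ℤ × ℤ → R := fun p => f (p.1 + p.2) * g (p.1 - p.2) with hF
  have he' : HasSum (F ∘ fun p : ℤ × ℤ => (p.1 + p.2, p.1 - p.2))
      ((∑' n, f (2 * n)) * ∑' n, g (2 * n)) := by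
    refine he.congr_fun fun p => ?_
    simp only [hF, Function.comp]
    rw [show p.1 + p.2 + (p.1 - p.2) = 2 * p.1 by ring,
      show p.1 + p.2 - (p.1 - p.2) = 2 * p.2 by ring]
  have ho' : HasSum (F ∘ fun p : ℤ × ℤ => (p.1 + p.2 + 1, p.1 - p.2))
      ((∑' n, f (2 * n + 1)) * ∑' n, g (2 * n + 1)) := by
    refine ho.congr_fun fun p => ?_
    simp only [hF, Function.comp]
    rw [show p.1 + p.2 + 1 + (p.1 - p.2) = 2 * p.1 + 1 by ring,
      show p.1 + p.2 + 1 - (p.1 - p.2) = 2 * p.2 + 1 by ring]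
  clear_value F
  exact HasSum.add_isCompl isCompl_range_add_sub (hi.hasSum_range_iff.2 he')
    (hj.hasSum_range_iff.2 ho')

end IntegerSums

/-- The series `∑ nʲ exp(-πtn²) exp(2πinx)` over the integers. -/
noncomputable def gaussSeries (j : ℕ) (x t : ℝ) : ℂ :=
  ∑' n : ℤ, (n : ℂ) ^ j * (Real.exp (-π * t * n ^ 2) : ℝ) * Complex.exp (2 * π * Complex.I * n * x)

/-- The theta constant `θ₃` as a function of `t`, where `q = exp(-πt)`. -/
noncomputable def thetaThree (t : ℝ) : ℝ := ∑' n : ℤ, Real.exp (-π * t * n ^ 2)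

/-- The series `∑ n² exp(-πtn²)` over the integers. -/
noncomputable def thetaMoment (t : ℝ) : ℝ := ∑' n : ℤ, (n : ℝ) ^ 2 * Real.exp (-π * t * n ^ 2)

/-- The theta constant `θ₂` as a function of `t`, where `q = exp(-πt)`. -/
noncomputable def thetaTwo (t : ℝ) : ℝ := thetaThree (t / 4) - thetaThree t

/-- The theta constant `θ₄` as a function of `t`, where `q = exp(-πt)`. -/
noncomputable def thetaFour (t : ℝ) : ℝ := 2 * thetaThree (4 * t) - thetaThree t

lemma summable_gauss (j : ℕ) {t : ℝ} (ht : 0 < t) :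
    Summable fun n : ℤ => |(n : ℝ)| ^ j * Real.exp (-π * t * n ^ 2) := by
  simpa [mul_assoc] using summable_pow_mul_jacobiTheta₂_term_bound 0 ht j

lemma norm_gaussSeries_term (j : ℕ) (x t : ℝ) (n : ℤ) :
    ‖(n : ℂ) ^ j * (Real.exp (-π * t * n ^ 2) : ℝ) *
      Complex.exp (2 * π * Complex.I * n * x)‖ = |(n : ℝ)| ^ j * Real.exp (-π * t * n ^ 2) := by
  have h : (2 * π * Complex.I * n * x : ℂ) = ((2 * π * n * x : ℝ) : ℂ) * Complex.I := by
    push_cast; ring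
  rw [h, norm_mul, Complex.norm_exp_ofReal_mul_I, norm_mul, norm_pow, Complex.norm_real,
    Real.norm_of_nonneg (Real.exp_pos _).le, mul_one, Complex.norm_intCast]

lemma summable_norm_gaussSeries_term (j : ℕ) (x : ℝ) {t : ℝ} (ht : 0 < t) :
    Summable fun n : ℤ => ‖(n : ℂ) ^ j * (Real.exp (-π * t * n ^ 2) : ℝ) *
      Complex.exp (2 * π * Complex.I * n * x)‖ := by
  simpa only [norm_gaussSeries_term] using summable_gauss j ht

lemma gaussSeries_hasDerivAt_fst (j : ℕ) (x : ℝ) {t : ℝ} (ht : 0 < t) :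
    HasDerivAt (fun x => gaussSeries j x t)
      (2 * π * Complex.I * gaussSeries (j + 1) x t) x := by
  have h := hasDerivAt_tsum (𝕜 := ℝ) (F := ℂ) (y₀ := 0)
    (g := fun (n : ℤ) x => (n : ℂ) ^ j * (Real.exp (-π * t * n ^ 2) : ℝ) *
      Complex.exp (2 * π * Complex.I * n * (x : ℝ)))
    (g' := fun n x => 2 * π * Complex.I * ((n : ℂ) ^ (j + 1) * (Real.exp (-π * t * n ^ 2) : ℝ) *
      Complex.exp (2 * π * Complex.I * n * (x : ℝ))))
    ((summable_gauss (j + 1) ht).mul_left (2 * π)) (fun n y => ?_) (fun n y => ?_)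
    (summable_norm_gaussSeries_term j 0 ht).of_norm x
  · rw [tsum_mul_left] at h
    exact h
  · have h1 : HasDerivAt (fun x : ℝ => (2 * π * Complex.I * n * (x : ℝ) : ℂ))
        (2 * π * Complex.I * n) y := by
      simpa using (Complex.ofRealCLM.hasDerivAt (x := y)).const_mul (2 * π * Complex.I * n : ℂ)
    refine (h1.cexp.const_mul _).congr_deriv ?_
    ring
  · rw [norm_mul, norm_gaussSeries_term]
    simp [abs_of_pos pi_pos]

lemma gaussSeries_hasDerivAt_snd (j : ℕ) (x : ℝ) {t : ℝ} (ht : 0 < t) :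
    HasDerivAt (fun t => gaussSeries j x t) (-π * gaussSeries (j + 2) x t) t := by
  have h := hasDerivAt_tsum_of_isPreconnected (𝕜 := ℝ) (F := ℂ) (y₀ := t) (y := t)
    (t := Set.Ioi (t / 2))
    (g := fun (n : ℤ) t => (n : ℂ) ^ j * (Real.exp (-π * t * n ^ 2) : ℝ) *
      Complex.exp (2 * π * Complex.I * n * x))
    (g' := fun n t => -π * ((n : ℂ) ^ (j + 2) * (Real.exp (-π * t * n ^ 2) : ℝ) *
      Complex.exp (2 * π * Complex.I * n * x)))
    ((summable_gauss (j + 2) (half_pos ht)).mul_left π) isOpen_Ioi isPreconnected_Ioi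
    (fun n y _ => ?_) (fun n y hy => ?_) (half_lt_self ht)
    (summable_norm_gaussSeries_term j x ht).of_norm (half_lt_self ht)
  · rw [tsum_mul_left] at h
    exact h
  · have h1 : HasDerivAt (fun t : ℝ => -π * t * (n : ℝ) ^ 2) (-π * n ^ 2) y := by
      simpa using ((hasDerivAt_id y).const_mul (-π)).mul_const ((n : ℝ) ^ 2)
    refine ((h1.exp.ofReal_comp.const_mul ((n : ℂ) ^ j)).mul_const _).congr_deriv ?_
    push_cast
    ring
  · have hy' : t / 2 < y := hy
    rw [norm_mul, norm_gaussSeries_term]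
    simp only [norm_neg, Complex.norm_real, Real.norm_of_nonneg pi_pos.le]
    gcongr π * (_ * Real.exp ?_)
    nlinarith [mul_nonneg pi_pos.le (sq_nonneg (n : ℝ))]

lemma gaussSeries_zero_zero (t : ℝ) : gaussSeries 0 0 t = thetaThree t := by
  simp [gaussSeries, thetaThree, Complex.ofReal_tsum]

lemma gaussSeries_two_zero (t : ℝ) : gaussSeries 2 0 t = thetaMoment t := by
  simp [gaussSeries, thetaMoment, Complex.ofReal_tsum]

lemma HasDerivAt.of_ofReal {f : ℝ → ℝ} {f' : ℂ} {x : ℝ}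
    (h : HasDerivAt (fun y => (f y : ℂ)) f' x) : f' = f'.re ∧ HasDerivAt f f'.re x := by
  have h1 : HasDerivAt f f'.re x := by
    exact Complex.reCLM.hasFDerivAt.comp_hasDerivAt x h
  exact ⟨h.unique h1.ofReal_comp, h1⟩

lemma thetaThree_hasDerivAt {t : ℝ} (ht : 0 < t) :
    HasDerivAt thetaThree (-π * thetaMoment t) t := by
  have h := gaussSeries_hasDerivAt_snd 0 0 ht
  simp only [gaussSeries_zero_zero, zero_add, gaussSeries_two_zero] at h
  simpa using h.of_ofReal.2

lemma gaussSeries_add_one (j : ℕ) (x t : ℝ) : gaussSeries j (x + 1) t = gaussSeries j x t := by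
  refine tsum_congr fun n => ?_
  have h : (2 * π * Complex.I * n * ((x + 1 : ℝ) : ℂ) : ℂ) =
      2 * π * Complex.I * n * x + n * (2 * π * Complex.I) := by push_cast; ring
  rw [h, Complex.exp_add, Complex.exp_int_mul_two_pi_mul_I, mul_one]

lemma tsum_gaussSeries_two_mul (j : ℕ) (x t : ℝ) :
    ∑' n : ℤ, ((2 * n : ℤ) : ℂ) ^ j * (Real.exp (-π * t * (2 * n : ℤ) ^ 2) : ℝ) *
      Complex.exp (2 * π * Complex.I * (2 * n : ℤ) * x) =
    2 ^ j * gaussSeries j (2 * x) (4 * t) := by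
  rw [gaussSeries, ← tsum_mul_left]
  refine tsum_congr fun n => ?_
  push_cast
  ring_nf

lemma gaussSeries_add_half (x : ℝ) {t : ℝ} (ht : 0 < t) :
    gaussSeries 0 (x + 1 / 2) t = 2 * gaussSeries 0 (2 * x) (4 * t) - gaussSeries 0 x t := by
  have e1 := tsum_int_even_add_odd (summable_norm_gaussSeries_term 0 x ht).of_norm
  have e2 := tsum_int_even_add_odd (summable_norm_gaussSeries_term 0 (x + 1 / 2) ht).of_norm
  rw [tsum_gaussSeries_two_mul] at e1 e2
  have hodd : ∀ n : ℤ, Complex.exp (2 * π * Complex.I * (2 * n + 1 : ℤ) * (x + 1 / 2 : ℝ)) =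
      -Complex.exp (2 * π * Complex.I * (2 * n + 1 : ℤ) * x) := fun n => by
    have h : (2 * π * Complex.I * (2 * n + 1 : ℤ) * (x + 1 / 2 : ℝ) : ℂ) =
        2 * π * Complex.I * (2 * n + 1 : ℤ) * x + n * (2 * π * Complex.I) + π * Complex.I := by
      push_cast; ring
    rw [h, Complex.exp_add, Complex.exp_add, Complex.exp_int_mul_two_pi_mul_I, Complex.exp_pi_mul_I]
    ring
  simp only [hodd, mul_neg, tsum_neg] at e2
  have hx : 2 * (x + 1 / 2) = 2 * x + 1 := by ring
  rw [hx, gaussSeries_add_one] at e2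
  change gaussSeries 0 x t = _ at e1
  change gaussSeries 0 (x + 1 / 2) t = _ at e2
  linear_combination e1 + e2

lemma gaussSeries_zero_half {t : ℝ} (ht : 0 < t) : gaussSeries 0 (1 / 2) t = thetaFour t := by
  have h := gaussSeries_add_half 0 ht
  rw [zero_add, mul_zero, gaussSeries_zero_zero, gaussSeries_zero_zero] at h
  rw [h, thetaFour]
  push_cast
  rfl

lemma gaussSeries_mul_hasSum (i j : ℕ) (x : ℝ) {t : ℝ} (ht : 0 < t) :
    HasSum (fun p : ℤ × ℤ => (p.1 : ℂ) ^ i * (p.2 : ℂ) ^ j *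
      (Real.exp (-π * (t / 2) * (p.1 + p.2 : ℤ) ^ 2) : ℝ) *
      Complex.exp (2 * π * Complex.I * (p.1 + p.2 : ℤ) * x) *
      (Real.exp (-π * (t / 2) * (p.1 - p.2 : ℤ) ^ 2) : ℝ))
      (gaussSeries i x t * gaussSeries j x t) := by
  have hi := summable_norm_gaussSeries_term i x ht
  have hj := summable_norm_gaussSeries_term j x ht
  rw [gaussSeries, gaussSeries, tsum_mul_tsum_of_summable_norm hi hj]
  convert! (summable_mul_of_summable_norm hi hj).hasSum using 2 with p
  have h1 : Real.exp (-π * (t / 2) * (p.1 + p.2 : ℤ) ^ 2) *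
      Real.exp (-π * (t / 2) * (p.1 - p.2 : ℤ) ^ 2) =
      Real.exp (-π * t * p.1 ^ 2) * Real.exp (-π * t * p.2 ^ 2) := by
    rw [← Real.exp_add, ← Real.exp_add]
    congr 1
    push_cast
    ring
  have h2 : Complex.exp (2 * π * Complex.I * (p.1 + p.2 : ℤ) * x) =
      Complex.exp (2 * π * Complex.I * p.1 * x) * Complex.exp (2 * π * Complex.I * p.2 * x) := by
    rw [← Complex.exp_add]
    congr 1
    push_cast
    ring
  rw [h2]
  have h1' := congrArg (fun r : ℝ => (r : ℂ)) h1
  simp only [Complex.ofReal_mul] at h1'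
  linear_combination (p.1 : ℂ) ^ i * (p.2 : ℂ) ^ j * Complex.exp (2 * π * Complex.I * p.1 * x) *
    Complex.exp (2 * π * Complex.I * p.2 * x) * h1'

lemma gaussSeries_parity_hasSum (j : ℕ) (x : ℝ) {t : ℝ} (ht : 0 < t) :
    HasSum (fun p : ℤ × ℤ => ((p.1 - p.2 : ℤ) : ℂ) ^ j *
      (Real.exp (-π * (t / 2) * (p.1 + p.2 : ℤ) ^ 2) : ℝ) *
      Complex.exp (2 * π * Complex.I * (p.1 + p.2 : ℤ) * x) *
      (Real.exp (-π * (t / 2) * (p.1 - p.2 : ℤ) ^ 2) : ℝ))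
      (gaussSeries 0 (2 * x) (2 * t) * (2 ^ j * gaussSeries j 0 (2 * t)) +
        (gaussSeries 0 x (t / 2) - gaussSeries 0 (2 * x) (2 * t)) *
        (gaussSeries j 0 (t / 2) - 2 ^ j * gaussSeries j 0 (2 * t))) := by
  have h := hasSum_add_sub (summable_norm_gaussSeries_term 0 x (half_pos ht))
    (summable_norm_gaussSeries_term j 0 (half_pos ht))
  have e : 4 * (t / 2) = 2 * t := by ring
  rw [tsum_gaussSeries_two_mul, tsum_gaussSeries_two_mul, e, mul_zero, pow_zero, one_mul] at h
  convert! h using 2 with p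
  simp
  ring

lemma gaussSeries_sq (x : ℝ) {t : ℝ} (ht : 0 < t) :
    gaussSeries 0 x t ^ 2 = gaussSeries 0 (2 * x) (2 * t) * thetaThree (2 * t) +
      (gaussSeries 0 x (t / 2) - gaussSeries 0 (2 * x) (2 * t)) * thetaTwo (2 * t) := by
  have h1 := gaussSeries_mul_hasSum 0 0 x ht
  have h2 := gaussSeries_parity_hasSum 0 x ht
  simp only [pow_zero, one_mul] at h1 h2
  rw [sq, h1.unique h2, gaussSeries_zero_zero, gaussSeries_zero_zero, thetaTwo,
    show 2 * t / 4 = t / 2 by ring]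
  push_cast
  rfl

lemma gaussSeries_wronskian (x : ℝ) {t : ℝ} (ht : 0 < t) :
    2 * (gaussSeries 0 x t * gaussSeries 2 x t - gaussSeries 1 x t ^ 2) =
      gaussSeries 0 (2 * x) (2 * t) * (4 * thetaMoment (2 * t)) +
      (gaussSeries 0 x (t / 2) - gaussSeries 0 (2 * x) (2 * t)) *
        (thetaMoment (t / 2) - 4 * thetaMoment (2 * t)) := by
  have h1 := ((gaussSeries_mul_hasSum 0 2 x ht).add (gaussSeries_mul_hasSum 2 0 x ht)).sub
    ((gaussSeries_mul_hasSum 1 1 x ht).mul_left 2)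
  have h2 := gaussSeries_parity_hasSum 2 x ht
  have h3 := h1.unique (h2.congr_fun fun p => by push_cast; ring)
  rw [gaussSeries_two_zero, gaussSeries_two_zero] at h3
  linear_combination h3

open Filter Topology in
lemma eq_of_map_two_mul_of_tendsto {f : ℝ → ℝ} {c : ℝ} (h2 : ∀ t, 0 < t → f t = f (2 * t))
    (hf : Tendsto f atTop (𝓝 c)) {t : ℝ} (ht : 0 < t) : f t = c := by
  have hpow : ∀ n : ℕ, f (2 ^ n * t) = f t := fun n => by
    induction n with
    | zero => simp
    | succ n ih => rw [← ih, h2 (2 ^ n * t) (by positivity), pow_succ']; ring_nf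
  have hlim : Tendsto (fun n : ℕ => 2 ^ n * t) atTop atTop :=
    (tendsto_pow_atTop_atTop_of_one_lt one_lt_two).atTop_mul_const ht
  have := hf.comp hlim
  simp only [Function.comp_def, hpow] at this
  exact tendsto_nhds_unique tendsto_const_nhds this

lemma summable_thetaThree {t : ℝ} (ht : 0 < t) :
    Summable fun n : ℤ => Real.exp (-π * t * n ^ 2) := by
  simpa using summable_gauss 0 ht

lemma thetaThree_pos {t : ℝ} (ht : 0 < t) : 0 < thetaThree t :=
  (summable_thetaThree ht).tsum_pos (fun _ => (Real.exp_pos _).le) 0 (Real.exp_pos _)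

lemma thetaTwo_pos {t : ℝ} (ht : 0 < t) : 0 < thetaTwo t := by
  have hs := summable_thetaThree (t := t / 4) (by positivity)
  have h := tsum_int_even_add_odd hs
  have he : ∑' n : ℤ, Real.exp (-π * (t / 4) * (2 * n : ℤ) ^ 2) = thetaThree t :=
    tsum_congr fun n => by push_cast; ring_nf
  have h3 : Function.Injective fun n : ℤ => 2 * n + 1 := fun a b h => by simpa using h
  have hpos := (hs.comp_injective h3).tsum_pos (fun _ => (Real.exp_pos _).le) 0 (Real.exp_pos _)
  simp only [Function.comp_def] at hpos
  rw [he] at h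
  rw [thetaTwo, thetaThree, h]
  linarith

lemma exists_pos_gaussSeries_eq (x : ℝ) {t : ℝ} (ht : 0 < t) :
    ∃ r : ℝ, 0 < r ∧ gaussSeries 0 x t = r := by
  have hs : Summable fun n : ℤ => Real.exp (-π / t * (n - x) ^ 2) := by
    refine ((summable_pow_mul_jacobiTheta₂_term_bound (|x| / t) (inv_pos.2 ht) 0).mul_left
      (Real.exp (-π / t * x ^ 2))).of_nonneg_of_le (fun _ => (Real.exp_pos _).le) fun n => ?_
    rw [pow_zero, one_mul, ← Real.exp_add]
    gcongr
    have h1 : (n : ℝ) * x ≤ |(n : ℝ)| * |x| := by rw [← abs_mul]; exact le_abs_self _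
    have h2 : 0 < π / t := by positivity
    have e1 : -π / t * ((n : ℝ) - x) ^ 2 =
        -(π / t) * x ^ 2 - (π / t) * n ^ 2 + 2 * (π / t) * (n * x) := by ring
    have e2 : -π / t * x ^ 2 + -π * (t⁻¹ * (n : ℝ) ^ 2 - 2 * (|x| / t) * |(n : ℝ)|) =
        -(π / t) * x ^ 2 - (π / t) * n ^ 2 + 2 * (π / t) * (|(n : ℝ)| * |x|) := by
      field_simp
      ring
    rw [Int.cast_abs] at *
    rw [e1, e2]
    nlinarith [mul_le_mul_of_nonneg_left h1 h2.le]
  refine ⟨1 / t ^ (1 / 2 : ℝ) * ∑' n : ℤ, Real.exp (-π / t * (n - x) ^ 2),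
    mul_pos (by positivity) (hs.tsum_pos (fun _ => (Real.exp_pos _).le) 0 (Real.exp_pos _)), ?_⟩
  have h := Complex.tsum_exp_neg_quadratic (a := t) (by simpa using ht) (Complex.I * x)
  have hl : gaussSeries 0 x t = ∑' n : ℤ, Complex.exp (-π * t * n ^ 2 +
      2 * π * (Complex.I * x) * n) := by
    refine tsum_congr fun n => ?_
    rw [Complex.exp_add, pow_zero, one_mul]
    push_cast
    ring_nf
  rw [hl, h]
  push_cast [Complex.ofReal_cpow ht.le]
  congr 1
  refine tsum_congr fun n => ?_
  rw [← mul_assoc, Complex.I_mul_I]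
  ring_nf

lemma thetaFour_pos {t : ℝ} (ht : 0 < t) : 0 < thetaFour t := by
  obtain ⟨r, hr, h⟩ := exists_pos_gaussSeries_eq (1 / 2) ht
  rw [gaussSeries_zero_half ht] at h
  rw [Complex.ofReal_injective h]
  exact hr

lemma thetaThree_inv {t : ℝ} (ht : 0 < t) : thetaThree t⁻¹ = √t * thetaThree t := by
  have h := Real.tsum_exp_neg_mul_int_sq ht
  rw [← Real.sqrt_eq_rpow] at h
  have e : ∀ n : ℤ, Real.exp (-π / t * n ^ 2) = Real.exp (-π * t⁻¹ * n ^ 2) := fun n => by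
    rw [div_eq_mul_inv]
  simp only [e] at h
  change thetaThree t = _ * thetaThree t⁻¹ at h
  have := Real.sqrt_pos.2 ht
  rw [h]
  field_simp

lemma thetaFour_inv {t : ℝ} (ht : 0 < t) : thetaFour t⁻¹ = √t * thetaTwo t := by
  have h1 : 4 * t⁻¹ = (t / 4)⁻¹ := by field_simp
  have h2 : √(t / 4) = √t / 2 := by
    rw [Real.sqrt_div' _ (by norm_num), show (4 : ℝ) = 2 ^ 2 by norm_num,
      Real.sqrt_sq (by norm_num)]
  rw [thetaFour, h1, thetaThree_inv (by positivity), thetaThree_inv ht, h2, thetaTwo]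
  ring

lemma thetaThree_sq {t : ℝ} (ht : 0 < t) :
    thetaThree t ^ 2 = thetaThree (2 * t) ^ 2 + thetaTwo (2 * t) ^ 2 := by
  have h := gaussSeries_sq 0 ht
  simp only [mul_zero, gaussSeries_zero_zero] at h
  have e : thetaTwo (2 * t) = thetaThree (t / 2) - thetaThree (2 * t) := by
    rw [thetaTwo]; ring_nf
  rw [← Complex.ofReal_inj]
  push_cast
  rw [h, e]
  push_cast
  ring

lemma thetaFour_sq {t : ℝ} (ht : 0 < t) :
    thetaFour t ^ 2 = thetaThree (2 * t) ^ 2 - thetaTwo (2 * t) ^ 2 := by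
  have h := gaussSeries_sq (1 / 2) ht
  have e1 : gaussSeries 0 (2 * (1 / 2)) (2 * t) = thetaThree (2 * t) := by
    rw [← gaussSeries_zero_zero, ← gaussSeries_add_one 0 0]; norm_num
  have e : thetaFour (t / 2) - thetaThree (2 * t) = -thetaTwo (2 * t) := by
    rw [thetaTwo, thetaFour]; ring_nf
  rw [e1, gaussSeries_zero_half ht, gaussSeries_zero_half (half_pos ht)] at h
  rw [← Complex.ofReal_inj]
  have e' := congrArg (fun r : ℝ => (r : ℂ)) e
  push_cast at e' ⊢
  rw [h, e']
  ring

lemma thetaTwo_sq {t : ℝ} (ht : 0 < t) :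
    thetaTwo t ^ 2 = 2 * thetaTwo (2 * t) * thetaThree (2 * t) := by
  have h1 := thetaThree_sq ht
  have h2 := thetaThree_sq (half_pos ht)
  have h3 : thetaThree (t / 2) = thetaTwo (2 * t) + thetaThree (2 * t) := by
    rw [thetaTwo]; ring_nf
  rw [h3, mul_div_cancel₀ _ two_ne_zero] at h2
  linear_combination -h1 - h2

lemma thetaFour_two_mul_sq {t : ℝ} (ht : 0 < t) :
    thetaFour (2 * t) ^ 2 = thetaThree t * thetaFour t := by
  have h1 : thetaFour (2 * t) ^ 2 = thetaThree (4 * t) ^ 2 - thetaTwo (4 * t) ^ 2 := by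
    rw [thetaFour_sq (by positivity)]; ring_nf
  have h2 : thetaTwo (4 * t) = thetaThree t - thetaThree (4 * t) := by rw [thetaTwo]; ring_nf
  rw [h1, h2, thetaFour]
  ring

lemma thetaTwo_pow_four_add {t : ℝ} (ht : 0 < t) :
    thetaTwo t ^ 4 + thetaFour t ^ 4 = thetaThree t ^ 4 := by
  have h1 := thetaThree_sq ht
  have h2 := thetaTwo_sq ht
  have h3 := thetaFour_sq ht
  calc thetaTwo t ^ 4 + thetaFour t ^ 4 = (thetaTwo t ^ 2) ^ 2 + (thetaFour t ^ 2) ^ 2 := by ring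
    _ = (thetaThree t ^ 2) ^ 2 := by rw [h1, h2, h3]; ring
    _ = _ := by ring

lemma thetaTwo_hasDerivAt {t : ℝ} (ht : 0 < t) :
    HasDerivAt thetaTwo (-π * (thetaMoment (t / 4) / 4 - thetaMoment t)) t := by
  have h1 : HasDerivAt (fun t : ℝ => t / 4) (1 / 4) t := (hasDerivAt_id t).div_const 4
  refine (((thetaThree_hasDerivAt (t := t / 4) (by positivity)).comp t h1).sub
    (thetaThree_hasDerivAt ht)).congr_deriv ?_
  ring

section Asymptotics

open Filter Topology

lemma tendsto_exp_mul_tsum_gauss {c : ℤ → ℝ} (h0 : c 0 = 0) (hc : ∀ n, |c n| ≤ (n : ℝ) ^ 2) :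
    Tendsto (fun t : ℝ => Real.exp (π * t) * ∑' n : ℤ, c n * Real.exp (-π * t * n ^ 2)) atTop
      (𝓝 (c 1 + c (-1))) := by
  have hlim : ∑' n : ℤ, (if n ∈ ({1, -1} : Finset ℤ) then c n else 0) = c 1 + c (-1) := by
    rw [tsum_eq_sum (s := {1, -1}) (fun b hb => if_neg hb)]
    simp
  rw [← hlim]
  simp only [← tsum_mul_left]
  refine tendsto_tsum_of_dominated_convergence
    (bound := fun n : ℤ => Real.exp π * (|(n : ℝ)| ^ 2 * Real.exp (-π * 1 * n ^ 2)))
    ((summable_gauss 2 one_pos).mul_left _) (fun n => ?_) ?_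
  · have e : ∀ t : ℝ, Real.exp (π * t) * (c n * Real.exp (-π * t * n ^ 2)) =
        c n * Real.exp (-(π * (n ^ 2 - 1)) * t) := fun t => by
      rw [mul_left_comm, ← Real.exp_add]; ring_nf
    simp only [e]
    by_cases hn : n ∈ ({1, -1} : Finset ℤ)
    · rw [if_pos hn]
      have : ((n : ℝ) ^ 2 - 1) = 0 := by
        rcases Finset.mem_insert.1 hn with rfl | h
        · norm_num
        · rw [Finset.mem_singleton.1 h]; norm_num
      simp [this]
    · rw [if_neg hn]
      by_cases hz : n = 0
      · simp [hz, h0]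
      have h2 : (1 : ℝ) < n ^ 2 := by
        have : (1 : ℤ) < n ^ 2 := by
          simp only [Finset.mem_insert, Finset.mem_singleton, not_or] at hn
          rcases lt_or_gt_of_ne hz with h | h
          · have : n ≤ -2 := by omega
            nlinarith
          · have : 2 ≤ n := by omega
            nlinarith
        exact_mod_cast this
      have hp : 0 < π * ((n : ℝ) ^ 2 - 1) := mul_pos pi_pos (by linarith)
      have := (Real.tendsto_exp_neg_atTop_nhds_zero.comp
        (tendsto_id.const_mul_atTop hp)).const_mul (c n)
      simpa [Function.comp_def] using this
  · filter_upwards [eventually_ge_atTop 1] with t ht n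
    rw [norm_mul, norm_mul, Real.norm_of_nonneg (Real.exp_pos _).le,
      Real.norm_of_nonneg (Real.exp_pos _).le, Real.norm_eq_abs, sq_abs]
    by_cases hz : n = 0
    · simp [hz, h0]
    have h1 : (1 : ℝ) ≤ n ^ 2 := by
      have : (1 : ℤ) ≤ n ^ 2 := by have := sq_pos_of_ne_zero hz; omega
      exact_mod_cast this
    have h2 : Real.exp (π * t) * Real.exp (-π * t * n ^ 2) ≤
        Real.exp π * Real.exp (-π * 1 * n ^ 2) := by
      rw [← Real.exp_add, ← Real.exp_add]
      apply Real.exp_le_exp.2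
      nlinarith [mul_nonneg (mul_nonneg pi_pos.le (sub_nonneg.2 ht)) (sub_nonneg.2 h1)]
    calc Real.exp (π * t) * (|c n| * Real.exp (-π * t * n ^ 2))
        = |c n| * (Real.exp (π * t) * Real.exp (-π * t * n ^ 2)) := by ring
      _ ≤ (n : ℝ) ^ 2 * (Real.exp π * Real.exp (-π * 1 * n ^ 2)) := by
          gcongr
          exact hc n
      _ = _ := by ring

lemma tendsto_exp_mul_thetaMoment :
    Tendsto (fun t => Real.exp (π * t) * thetaMoment t) atTop (𝓝 2) := by
  have := tendsto_exp_mul_tsum_gauss (c := fun n => (n : ℝ) ^ 2) (by simp)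
    (fun n => (abs_of_nonneg (sq_nonneg _)).le)
  have e : (2 : ℝ) = ((1 : ℤ) : ℝ) ^ 2 + ((-1 : ℤ) : ℝ) ^ 2 := by norm_num
  rw [e]
  exact this

lemma tendsto_exp_mul_thetaThree_sub_one :
    Tendsto (fun t => Real.exp (π * t) * (thetaThree t - 1)) atTop (𝓝 2) := by
  have := tendsto_exp_mul_tsum_gauss (c := fun n => if n = 0 then 0 else 1) (by simp)
    (fun n => by
      split_ifs with h
      · simp [h]
      · have : (1 : ℤ) ≤ n ^ 2 := by have := sq_pos_of_ne_zero h; omega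
        rw [abs_one]
        exact_mod_cast this)
  norm_num at this
  refine this.congr' ?_
  filter_upwards [eventually_gt_atTop 0] with t ht
  congr 1
  rw [thetaThree, (summable_thetaThree ht).tsum_eq_add_tsum_ite 0]
  simp

lemma tendsto_exp_neg_mul_atTop {c : ℝ} (hc : 0 < c) :
    Tendsto (fun t => Real.exp (-(c * t))) atTop (𝓝 0) :=
  Real.tendsto_exp_neg_atTop_nhds_zero.comp (tendsto_id.const_mul_atTop hc)

lemma tendsto_thetaThree : Tendsto thetaThree atTop (𝓝 1) := by
  have := ((tendsto_exp_neg_mul_atTop pi_pos).mul tendsto_exp_mul_thetaThree_sub_one).add_const 1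
  rw [zero_mul, zero_add] at this
  refine this.congr fun t => ?_
  rw [← mul_assoc, ← Real.exp_add]
  simp

lemma tendsto_thetaMoment : Tendsto thetaMoment atTop (𝓝 0) := by
  have := (tendsto_exp_neg_mul_atTop pi_pos).mul tendsto_exp_mul_thetaMoment
  rw [zero_mul] at this
  refine this.congr fun t => ?_
  rw [← mul_assoc, ← Real.exp_add]
  simp

lemma tendsto_thetaFour : Tendsto thetaFour atTop (𝓝 1) := by
  have h : Tendsto (fun t : ℝ => 4 * t) atTop atTop := tendsto_id.const_mul_atTop (by norm_num)
  have := ((tendsto_thetaThree.comp h).const_mul 2).sub tendsto_thetaThree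
  norm_num at this
  exact this

lemma tendsto_exp_mul_sub {f : ℝ → ℝ} {c : ℝ}
    (hf : Tendsto (fun t => Real.exp (π * t) * f t) atTop (𝓝 c)) (a : ℝ) :
    Tendsto (fun t => Real.exp (π * (t / 4)) * (a * f (t / 4) - f t)) atTop (𝓝 (a * c)) := by
  have h4 : Tendsto (fun t : ℝ => t / 4) atTop atTop := tendsto_id.atTop_div_const (by norm_num)
  have h1 := (hf.comp h4).const_mul a
  have h2 := (tendsto_exp_neg_mul_atTop (c := 3 / 4 * π) (by positivity)).mul hf
  have := h1.sub h2
  rw [zero_mul, sub_zero] at this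
  refine this.congr fun t => ?_
  rw [← mul_assoc, ← Real.exp_add]
  simp only [Function.comp]
  ring_nf

lemma tendsto_exp_mul_thetaTwo :
    Tendsto (fun t => Real.exp (π * (t / 4)) * thetaTwo t) atTop (𝓝 2) := by
  have := tendsto_exp_mul_sub tendsto_exp_mul_thetaThree_sub_one 1
  rw [one_mul] at this
  refine this.congr fun t => ?_
  rw [thetaTwo]
  ring

lemma tendsto_thetaTwo : Tendsto thetaTwo atTop (𝓝 0) := by
  have h4 : Tendsto (fun t : ℝ => t / 4) atTop atTop := tendsto_id.atTop_div_const (by norm_num)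
  have := (tendsto_thetaThree.comp h4).sub tendsto_thetaThree
  rw [sub_self] at this
  exact this

end Asymptotics

/-- The logarithmic derivative of `θ₂ / θ₃`. -/
noncomputable def thetaLogDeriv (t : ℝ) : ℝ :=
  -π * (thetaMoment (t / 4) / 4 - thetaMoment t) / thetaTwo t - -π * thetaMoment t / thetaThree t

lemma thetaThree_mul_deriv {t : ℝ} (ht : 0 < t) :
    thetaThree t * (-π * thetaMoment t) = 2 * thetaThree (2 * t) * (-π * thetaMoment (2 * t)) +
      2 * thetaTwo (2 * t) * (-π * (thetaMoment (2 * t / 4) / 4 - thetaMoment (2 * t))) := by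
  have h2t : HasDerivAt (fun t : ℝ => 2 * t) 2 t := by
    simpa using (hasDerivAt_id t).const_mul 2
  have hA := (thetaThree_hasDerivAt (t := 2 * t) (by positivity)).comp t h2t
  have hB := (thetaTwo_hasDerivAt (t := 2 * t) (by positivity)).comp t h2t
  have h1 := (thetaThree_hasDerivAt ht).pow 2
  have h2 := ((hA.pow 2).add (hB.pow 2)).congr_of_eventuallyEq (f₁ := fun t => thetaThree t ^ 2) (by
    filter_upwards [lt_mem_nhds ht] with s hs using thetaThree_sq hs)
  have := h1.unique h2
  simp only [Function.comp, Nat.cast_ofNat, Nat.add_one_sub_one, pow_one] at this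
  linear_combination this / 2

lemma thetaTwo_mul_deriv {t : ℝ} (ht : 0 < t) :
    thetaTwo t * (-π * (thetaMoment (t / 4) / 4 - thetaMoment t)) =
      2 * thetaTwo (2 * t) * (-π * thetaMoment (2 * t)) +
      2 * thetaThree (2 * t) * (-π * (thetaMoment (2 * t / 4) / 4 - thetaMoment (2 * t))) := by
  have h2t : HasDerivAt (fun t : ℝ => 2 * t) 2 t := by
    simpa using (hasDerivAt_id t).const_mul 2
  have hA := (thetaThree_hasDerivAt (t := 2 * t) (by positivity)).comp t h2t
  have hB := (thetaTwo_hasDerivAt (t := 2 * t) (by positivity)).comp t h2t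
  have h1 := (thetaTwo_hasDerivAt ht).pow 2
  have h2 := ((hB.const_mul 2).mul hA).congr_of_eventuallyEq (f₁ := fun t => thetaTwo t ^ 2) (by
    filter_upwards [lt_mem_nhds ht] with s hs using thetaTwo_sq hs)
  have := h1.unique h2
  simp only [Function.comp, Nat.cast_ofNat, Nat.add_one_sub_one, pow_one] at this
  linear_combination this / 2

lemma thetaLogDeriv_eq_two_mul {t : ℝ} (ht : 0 < t) :
    thetaLogDeriv t / thetaFour t ^ 4 = thetaLogDeriv (2 * t) / thetaFour (2 * t) ^ 4 := by
  have h2 : 0 < 2 * t := by positivity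
  have e3 := thetaThree_mul_deriv ht
  have e2 := thetaTwo_mul_deriv ht
  have s3 := thetaThree_sq ht
  have s2 := thetaTwo_sq ht
  have s4 := thetaFour_sq ht
  have q := thetaTwo_pow_four_add h2
  have p2 := thetaTwo_pos ht
  have p3 := thetaThree_pos ht
  have p4 := thetaFour_pos ht
  have P2 := thetaTwo_pos h2
  have P3 := thetaThree_pos h2
  have P4 := thetaFour_pos h2
  unfold thetaLogDeriv
  set a := thetaThree (2 * t)
  set b := thetaTwo (2 * t)
  set a' := -π * thetaMoment (2 * t)
  set b' := -π * (thetaMoment (2 * t / 4) / 4 - thetaMoment (2 * t))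
  have l2 : -π * (thetaMoment (t / 4) / 4 - thetaMoment t) / thetaTwo t = b' / b + a' / a := by
    have : -π * (thetaMoment (t / 4) / 4 - thetaMoment t) / thetaTwo t =
        thetaTwo t * (-π * (thetaMoment (t / 4) / 4 - thetaMoment t)) / thetaTwo t ^ 2 := by
      field_simp
    rw [this, e2, s2]
    field_simp
    ring
  have l3 : -π * thetaMoment t / thetaThree t = 2 * (a * a' + b * b') / (a ^ 2 + b ^ 2) := by
    have : -π * thetaMoment t / thetaThree t =
        thetaThree t * (-π * thetaMoment t) / thetaThree t ^ 2 := by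
      field_simp
    rw [this, e3, s3]
    ring
  have q1 : thetaFour t ^ 4 = (a ^ 2 - b ^ 2) ^ 2 := by rw [← s4]; ring
  have q2 : thetaFour (2 * t) ^ 4 = (a ^ 2 - b ^ 2) * (a ^ 2 + b ^ 2) := by
    linear_combination q
  have hab : a ^ 2 - b ^ 2 ≠ 0 := by rw [← s4]; positivity
  rw [l2, l3, q1, q2]
  field_simp
  ring

open Filter Topology in
/-- The logarithmic derivative of `θ₂ / θ₃` is a multiple of `θ₄⁴`. -/
lemma thetaLogDeriv_eq {t : ℝ} (ht : 0 < t) :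
    thetaLogDeriv t = -(π / 4) * thetaFour t ^ 4 := by
  have hlim : Tendsto (fun t => thetaLogDeriv t / thetaFour t ^ 4) atTop (𝓝 (-(π / 4))) := by
    have h1 : Tendsto (fun t => -π * (Real.exp (π * (t / 4)) *
        (1 / 4 * thetaMoment (t / 4) - thetaMoment t)) / (Real.exp (π * (t / 4)) * thetaTwo t))
        atTop (𝓝 (-π * (1 / 4 * 2) / 2)) :=
      ((tendsto_exp_mul_sub tendsto_exp_mul_thetaMoment (1 / 4)).const_mul (-π)).div
        tendsto_exp_mul_thetaTwo two_ne_zero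
    have h2 := ((tendsto_thetaMoment.const_mul (-π)).div tendsto_thetaThree one_ne_zero)
    have h3 := (h1.sub h2).div (tendsto_thetaFour.pow 4) (by norm_num)
    have e : (-π * (1 / 4 * 2) / 2 - -π * 0 / 1) / 1 ^ 4 = -(π / 4) := by ring
    rw [e] at h3
    refine h3.congr fun t => ?_
    simp only [thetaLogDeriv, Pi.div_apply]
    congr 2
    have := Real.exp_pos (π * (t / 4))
    rw [mul_left_comm, mul_div_mul_left _ _ this.ne']
    ring
  have := eq_of_map_two_mul_of_tendsto (f := fun t => thetaLogDeriv t / thetaFour t ^ 4)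
    (fun t ht => thetaLogDeriv_eq_two_mul ht) hlim ht
  have p := thetaFour_pos ht
  field_simp at this
  linear_combination this / 4

/-- The elliptic modulus `θ₂² / θ₃²` with nome `exp(-πt)`. -/
noncomputable def thetaModulus (t : ℝ) : ℝ := thetaTwo t ^ 2 / thetaThree t ^ 2

lemma thetaModulus_pos {t : ℝ} (ht : 0 < t) : 0 < thetaModulus t :=
  div_pos (pow_pos (thetaTwo_pos ht) 2) (pow_pos (thetaThree_pos ht) 2)

lemma one_sub_thetaModulus_sq {t : ℝ} (ht : 0 < t) :
    1 - thetaModulus t ^ 2 = (thetaFour t ^ 2 / thetaThree t ^ 2) ^ 2 := by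
  have := thetaThree_pos ht
  rw [thetaModulus]
  field_simp
  linear_combination -thetaTwo_pow_four_add ht

lemma thetaModulus_sq_lt_one {t : ℝ} (ht : 0 < t) : thetaModulus t ^ 2 < 1 := by
  have := one_sub_thetaModulus_sq ht
  have h3 := thetaThree_pos ht
  have h4 := thetaFour_pos ht
  have : 0 < (thetaFour t ^ 2 / thetaThree t ^ 2) ^ 2 := by positivity
  linarith

lemma sqrt_one_sub_thetaModulus_sq {t : ℝ} (ht : 0 < t) :
    √(1 - thetaModulus t ^ 2) = thetaFour t ^ 2 / thetaThree t ^ 2 := by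
  rw [one_sub_thetaModulus_sq ht, Real.sqrt_sq (by positivity)]

lemma thetaModulus_inv {t : ℝ} (ht : 0 < t) : thetaModulus t⁻¹ = √(1 - thetaModulus t ^ 2) := by
  have h3 := thetaThree_pos (inv_pos.2 ht)
  have hs := Real.sqrt_pos.2 (inv_pos.2 ht)
  have e4 := thetaFour_inv (inv_pos.2 ht)
  have e3 := thetaThree_inv (inv_pos.2 ht)
  rw [inv_inv] at e3 e4
  rw [sqrt_one_sub_thetaModulus_sq ht, e3, e4, thetaModulus]
  field_simp

lemma thetaModulus_hasDerivAt {t : ℝ} (ht : 0 < t) :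
    HasDerivAt thetaModulus (-(π / 2) * thetaModulus t * thetaFour t ^ 4) t := by
  have h2 := thetaTwo_pos ht
  have h3 := thetaThree_pos ht
  refine (((thetaTwo_hasDerivAt ht).pow 2).div ((thetaThree_hasDerivAt ht).pow 2)
    (pow_ne_zero 2 h3.ne')).congr_deriv ?_
  have e : -(π / 2) * thetaModulus t * thetaFour t ^ 4 =
      2 * thetaModulus t * thetaLogDeriv t := by
    rw [thetaLogDeriv_eq ht]; ring
  rw [e, thetaModulus, thetaLogDeriv]
  simp only [Nat.cast_ofNat, Nat.add_one_sub_one, pow_one, Pi.pow_apply]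
  field_simp

section Uniformization

open Filter Topology

lemma tendsto_thetaModulus : Tendsto thetaModulus atTop (𝓝 0) := by
  have := (tendsto_thetaTwo.pow 2).div (tendsto_thetaThree.pow 2) (by norm_num)
  rw [zero_pow two_ne_zero, zero_div] at this
  exact this

lemma EllK_thetaModulus {t : ℝ} (ht : 0 < t) :
    EllK (thetaModulus t) = π / 2 * thetaThree t ^ 2 := by
  have hlim : Tendsto (fun t => EllK (thetaModulus t) / thetaThree t ^ 2) atTop (𝓝 (π / 2)) := by
    have hK : Tendsto EllK (𝓝 0) (𝓝 (π / 2)) := by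
      rw [← EllK_zero]
      exact EllK_continuousAt (by norm_num)
    have := (hK.comp tendsto_thetaModulus).div (tendsto_thetaThree.pow 2) (by norm_num)
    rw [one_pow, div_one] at this
    exact this
  have h2 : ∀ t, 0 < t → EllK (thetaModulus t) / thetaThree t ^ 2 =
      EllK (thetaModulus (2 * t)) / thetaThree (2 * t) ^ 2 := fun t ht => by
    have ht2 : 0 < 2 * t := by positivity
    have p2 := thetaTwo_pos ht2
    have p3 := thetaThree_pos ht2
    have p3' := thetaThree_pos ht
    have hlt : thetaTwo (2 * t) / thetaThree (2 * t) < 1 := by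
      rw [← sq_lt_one_iff₀ (by positivity), div_pow, ← sq_lt_one_iff₀ (by positivity)]
      exact thetaModulus_sq_lt_one ht2
    have h := EllK_landen (r := thetaTwo (2 * t) / thetaThree (2 * t)) (by positivity) hlt
    have e1 : 2 * (thetaTwo (2 * t) / thetaThree (2 * t)) /
        (1 + (thetaTwo (2 * t) / thetaThree (2 * t)) ^ 2) = thetaModulus t := by
      rw [thetaModulus, thetaTwo_sq ht, thetaThree_sq ht]
      field_simp
    have e2 : 1 + (thetaTwo (2 * t) / thetaThree (2 * t)) ^ 2 =
        thetaThree t ^ 2 / thetaThree (2 * t) ^ 2 := by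
      rw [thetaThree_sq ht]
      field_simp
    rw [e1, e2, div_pow] at h
    rw [h, thetaModulus]
    field_simp
  have := eq_of_map_two_mul_of_tendsto
    (f := fun t => EllK (thetaModulus t) / thetaThree t ^ 2) h2 hlim ht
  have p3 := thetaThree_pos ht
  exact (div_eq_iff (by positivity)).1 this

lemma EllK'_thetaModulus_div {t : ℝ} (ht : 0 < t) :
    EllK' (thetaModulus t) / EllK (thetaModulus t) = t := by
  have p3 := thetaThree_pos ht
  rw [EllK', ← thetaModulus_inv ht, EllK_thetaModulus (inv_pos.2 ht), EllK_thetaModulus ht,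
    thetaThree_inv ht, mul_pow, Real.sq_sqrt ht.le]
  field_simp

lemma nome_thetaModulus {t : ℝ} (ht : 0 < t) : nome (thetaModulus t) = Real.exp (-π * t) := by
  rw [nome, mul_div_assoc, EllK'_thetaModulus_div ht]

lemma exists_thetaModulus_eq {k : ℝ} (hk : k ∈ Set.Ioo (0 : ℝ) 1) :
    ∃ t, 0 < t ∧ thetaModulus t = k := by
  obtain ⟨h0, h1⟩ := hk
  have hk' : 0 < √(1 - k ^ 2) := Real.sqrt_pos.2 (by nlinarith)
  obtain ⟨T, hT, hTk, hTk'⟩ := ((eventually_gt_atTop 0).and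
    ((tendsto_thetaModulus.eventually_lt_const h0).and
      (tendsto_thetaModulus.eventually_lt_const hk'))).exists
  have hTi : k < thetaModulus T⁻¹ := by
    rw [thetaModulus_inv hT]
    apply Real.lt_sqrt_of_sq_lt
    have := Real.lt_sqrt (thetaModulus_pos hT).le |>.1 hTk'
    linarith
  have hc : ContinuousOn thetaModulus (Set.Ioi 0) := fun s hs =>
    (thetaModulus_hasDerivAt hs).continuousAt.continuousWithinAt
  obtain ⟨t, ht, h⟩ := isPreconnected_Ioi.intermediate_value hT (inv_pos.2 hT) hc
    ⟨hTk.le, hTi.le⟩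
  exact ⟨t, ht, h⟩

lemma EllK'_div_EllK_hasDerivAt {t : ℝ} (ht : 0 < t) :
    HasDerivAt (fun k => EllK' k / EllK k)
      (-(π / 2) * thetaModulus t * thetaFour t ^ 4)⁻¹ (thetaModulus t) := by
  have hκ := thetaModulus_pos ht
  have hκ1 := thetaModulus_sq_lt_one ht
  have h4 := thetaFour_pos ht
  have hc : ContinuousAt (fun k => EllK' k / EllK k) (thetaModulus t) := by
    refine ContinuousAt.div ?_ (EllK_continuousAt hκ1) (EllK_pos hκ1).ne'
    have hs : ContinuousAt (fun k : ℝ => √(1 - k ^ 2)) (thetaModulus t) := by fun_prop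
    refine ContinuousAt.comp (g := EllK) (EllK_continuousAt ?_) hs
    rw [Real.sq_sqrt (by linarith)]
    nlinarith
  refine HasDerivAt.of_local_left_inverse hc (f := thetaModulus) ?_ ?_ ?_
  · rw [EllK'_thetaModulus_div ht]
    exact thetaModulus_hasDerivAt ht
  · have : 0 < π / 2 * thetaModulus t * thetaFour t ^ 4 := by positivity
    linarith
  · have h1 : thetaModulus t < 1 := by nlinarith
    filter_upwards [Ioo_mem_nhds hκ h1] with y hy
    obtain ⟨s, hs, rfl⟩ := exists_thetaModulus_eq hy
    rw [EllK'_thetaModulus_div hs]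

end Uniformization

lemma thetaThree_deriv_eq {t : ℝ} (ht : 0 < t) :
    -π * thetaMoment t = -(1 / 2) * thetaThree t ^ 3 * (EllE (thetaModulus t) -
      (1 - thetaModulus t ^ 2) * EllK (thetaModulus t)) := by
  have hκ := thetaModulus_pos ht
  have hκ1 := thetaModulus_sq_lt_one ht
  have h3 := thetaThree_pos ht
  have h4 := thetaFour_pos ht
  have h1 := (EllK_hasDerivAt hκ.ne' hκ1).comp t (thetaModulus_hasDerivAt ht)
  have h2 : HasDerivAt (EllK ∘ thetaModulus) _ t :=
    (((thetaThree_hasDerivAt ht).pow 2).const_mul (π / 2)).congr_of_eventuallyEq (by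
      filter_upwards [lt_mem_nhds ht] with s hs using EllK_thetaModulus hs)
  have h := h1.unique h2
  have hd : thetaFour t ^ 4 = (1 - thetaModulus t ^ 2) * thetaThree t ^ 4 := by
    rw [one_sub_thetaModulus_sq ht]
    field_simp
  have hκ2 : (1 - thetaModulus t ^ 2) ≠ 0 := by linarith
  simp only [Nat.cast_ofNat, Nat.add_one_sub_one, pow_one] at h
  rw [hd] at h
  have hpi := pi_pos
  have e : (EllE (thetaModulus t) - (1 - thetaModulus t ^ 2) * EllK (thetaModulus t)) /
      (thetaModulus t * (1 - thetaModulus t ^ 2)) * (-(π / 2) * thetaModulus t *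
      ((1 - thetaModulus t ^ 2) * thetaThree t ^ 4)) = -(π / 2) * thetaThree t ^ 4 *
      (EllE (thetaModulus t) - (1 - thetaModulus t ^ 2) * EllK (thetaModulus t)) := by
    field_simp
  rw [e] at h
  refine mul_left_cancel₀ (mul_pos pi_pos h3).ne' ?_
  linear_combination -h

lemma thetaThree_deriv_two_mul {t : ℝ} (ht : 0 < t) :
    -π * thetaMoment (2 * t) = thetaThree (2 * t) * (thetaThree t ^ 2 / 4) *
      (π / 2 * thetaFour t ^ 2 - EllE (thetaModulus t)) ∧
    -π * (thetaMoment (2 * t / 4) / 4 - thetaMoment (2 * t)) =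
      -(thetaTwo (2 * t) * (thetaThree t ^ 2 / 4) *
      (π / 2 * thetaFour t ^ 2 + EllE (thetaModulus t))) := by
  have ht2 : 0 < 2 * t := by positivity
  have p3 := thetaThree_pos ht
  have P2 := thetaTwo_pos ht2
  have P3 := thetaThree_pos ht2
  have hL := thetaLogDeriv_eq ht2
  have h4 : thetaFour (2 * t) ^ 4 = thetaThree t ^ 2 * thetaFour t ^ 2 := by
    rw [← mul_pow, ← thetaFour_two_mul_sq ht]; ring
  have hd := thetaThree_mul_deriv ht
  rw [thetaThree_deriv_eq ht, EllK_thetaModulus ht, one_sub_thetaModulus_sq ht] at hd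
  have s3 := thetaThree_sq ht
  have s4 := thetaFour_sq ht
  rw [h4, thetaLogDeriv] at hL
  set α := -π * thetaMoment (2 * t) / thetaThree (2 * t) with hα
  set β := -π * (thetaMoment (2 * t / 4) / 4 - thetaMoment (2 * t)) / thetaTwo (2 * t) with hβ
  have ea : -π * thetaMoment (2 * t) = thetaThree (2 * t) * α := by rw [hα]; field_simp
  have eb : -π * (thetaMoment (2 * t / 4) / 4 - thetaMoment (2 * t)) = thetaTwo (2 * t) * β := by
    rw [hβ]; field_simp
  rw [ea, eb] at hd
  have hβ' : β = α - π / 4 * (thetaThree t ^ 2 * thetaFour t ^ 2) := by linear_combination hL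
  have e : thetaThree t * (-(1 / 2) * thetaThree t ^ 3 * (EllE (thetaModulus t) -
      (thetaFour t ^ 2 / thetaThree t ^ 2) ^ 2 * (π / 2 * thetaThree t ^ 2))) =
      -(1 / 2) * thetaThree t ^ 2 * (thetaThree t ^ 2 * EllE (thetaModulus t) -
      thetaFour t ^ 4 * (π / 2)) := by
    field_simp
  have hα' : α = thetaThree t ^ 2 / 4 * (π / 2 * thetaFour t ^ 2 - EllE (thetaModulus t)) := by
    have h0 : 2 * thetaThree t ^ 2 ≠ 0 := by positivity
    refine mul_left_cancel₀ h0 ?_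
    rw [e, hβ'] at hd
    have hB : 2 * thetaTwo (2 * t) ^ 2 = thetaThree t ^ 2 - thetaFour t ^ 2 := by
      rw [s3, s4]; ring
    linear_combination -hd + 2 * α * s3 +
      π / 4 * (thetaThree t ^ 2 * thetaFour t ^ 2) * hB
  rw [ea, eb, hβ', hα']
  constructor <;> ring

lemma Summable.tsum_int_eq_add_tsum_nat {f : ℤ → ℂ} (hf : Summable f) :
    ∑' n, f n = f 0 + ∑' n : ℕ, (f (n + 1) + f (-(n + 1))) := by
  have h1 : Function.Injective fun n : ℕ => (n : ℤ) + 1 := fun a b h => by simpa using h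
  have h2 : Function.Injective fun n : ℕ => -((n : ℤ) + 1) := fun a b h => by simpa using h
  have s1 : Summable fun n : ℕ => f (n + 1) := hf.comp_injective h1
  have s2 : Summable fun n : ℕ => f (-(n + 1)) := hf.comp_injective h2
  rw [tsum_of_add_one_of_neg_add_one s1 s2, s1.tsum_add s2]
  ring

lemma gaussSeries_zero_eq_cos (x : ℝ) {t : ℝ} (ht : 0 < t) :
    gaussSeries 0 x t = (1 + 2 * ∑' n : ℕ, Real.exp (-π * t) ^ ((n + 1) ^ 2) *
      Real.cos (2 * π * (n + 1) * x) : ℝ) := by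
  rw [gaussSeries, (summable_norm_gaussSeries_term 0 x ht).of_norm.tsum_int_eq_add_tsum_nat,
    ← tsum_mul_left, Complex.ofReal_add, Complex.ofReal_tsum]
  congr 1
  · simp
  refine tsum_congr fun n => ?_
  have e : ∀ m : ℝ, m ^ 2 = ((n : ℝ) + 1) ^ 2 →
      Real.exp (-π * t * m ^ 2) = Real.exp (-π * t) ^ ((n + 1) ^ 2) := fun m hm => by
    rw [← Real.exp_nat_mul, hm]
    push_cast
    ring_nf
  rw [e _ (by push_cast; ring), e _ (by push_cast; ring)]
  generalize Real.exp (-π * t) ^ ((n + 1) ^ 2) = c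
  rw [Complex.ofReal_mul, Complex.ofReal_mul, Complex.ofReal_cos, Complex.cos]
  push_cast
  ring_nf

lemma JTheta1_thetaModulus (u : ℝ) {t : ℝ} (ht : 0 < t) :
    (JTheta1 u (thetaModulus t) : ℂ) =
      gaussSeries 0 (u / (2 * EllK (thetaModulus t))) t := by
  have hK := EllK_pos (thetaModulus_sq_lt_one ht)
  rw [gaussSeries_zero_eq_cos _ ht, JTheta1, nome_thetaModulus ht]
  congr! 7
  field_simp

lemma JTheta_thetaModulus (u : ℝ) {t : ℝ} (ht : 0 < t) :
    (JTheta u (thetaModulus t) : ℂ) =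
      gaussSeries 0 (u / (2 * EllK (thetaModulus t)) + 1 / 2) t := by
  have hK := EllK_pos (thetaModulus_sq_lt_one ht)
  rw [gaussSeries_zero_eq_cos _ ht, JTheta, nome_thetaModulus ht]
  congr! 5 with n
  have e : 2 * π * ((n : ℝ) + 1) * (u / (2 * EllK (thetaModulus t)) + 1 / 2) =
      ((n : ℝ) + 1) * π * u / EllK (thetaModulus t) + (n + 1 : ℕ) * π := by
    push_cast
    field_simp
  rw [e, Real.cos_add_nat_mul_pi]
  ring

lemma JTheta_ne_zero (u : ℝ) {t : ℝ} (ht : 0 < t) : JTheta u (thetaModulus t) ≠ 0 := by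
  obtain ⟨r, hr, h⟩ := exists_pos_gaussSeries_eq (u / (2 * EllK (thetaModulus t)) + 1 / 2) ht
  rw [← JTheta_thetaModulus u ht] at h
  rw [Complex.ofReal_injective h]
  exact hr.ne'

lemma gaussSeries_scaled_hasDerivAt (j : ℕ) (u c : ℝ) {t : ℝ} (ht : 0 < t) :
    HasDerivAt (fun u : ℝ => gaussSeries j (u / (2 * c) + 1 / 2) t)
      (π * Complex.I / c * gaussSeries (j + 1) (u / (2 * c) + 1 / 2) t) u := by
  have h1 : HasDerivAt (fun u : ℝ => u / (2 * c) + 1 / 2) (1 / (2 * c)) u :=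
    ((hasDerivAt_id u).div_const (2 * c)).add_const (1 / 2)
  refine ((gaussSeries_hasDerivAt_fst j (u / (2 * c) + 1 / 2) ht).scomp u h1).congr_deriv ?_
  rw [Complex.real_smul]
  push_cast
  ring

lemma deriv_JTheta_thetaModulus (u : ℝ) {t : ℝ} (ht : 0 < t) :
    ((deriv (fun v => JTheta v (thetaModulus t)) u : ℝ) : ℂ) =
      π * Complex.I / EllK (thetaModulus t) *
        gaussSeries 1 (u / (2 * EllK (thetaModulus t)) + 1 / 2) t := by
  have h := gaussSeries_scaled_hasDerivAt 0 u (EllK (thetaModulus t)) ht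
  simp only [← JTheta_thetaModulus _ ht] at h
  obtain ⟨h1, h2⟩ := h.of_ofReal
  rw [h2.deriv, ← h1]

lemma deriv_deriv_JTheta_thetaModulus (u : ℝ) {t : ℝ} (ht : 0 < t) :
    ((deriv (deriv (fun v => JTheta v (thetaModulus t))) u : ℝ) : ℂ) =
      -(π / EllK (thetaModulus t)) ^ 2 *
        gaussSeries 2 (u / (2 * EllK (thetaModulus t)) + 1 / 2) t := by
  have h := (gaussSeries_scaled_hasDerivAt 1 u (EllK (thetaModulus t)) ht).const_mul
    (π * Complex.I / EllK (thetaModulus t))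
  simp only [← deriv_JTheta_thetaModulus _ ht] at h
  obtain ⟨h1, h2⟩ := h.of_ofReal
  rw [h2.deriv, ← h1]
  linear_combination (π / EllK (thetaModulus t)) ^ 2 *
        gaussSeries 2 (u / (2 * EllK (thetaModulus t)) + 1 / 2) t * Complex.I_sq

/-- The differential equation satisfied by `Θ`, from which `(log Θ)'' = dn² - E / K`. -/
lemma JTheta_mul_deriv_deriv_sub (u : ℝ) {t : ℝ} (ht : 0 < t) :
    JTheta u (thetaModulus t) * deriv (deriv (fun v => JTheta v (thetaModulus t))) u -
      deriv (fun v => JTheta v (thetaModulus t)) u ^ 2 =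
    √(1 - thetaModulus t ^ 2) * JTheta1 u (thetaModulus t) ^ 2 -
      EllE (thetaModulus t) / EllK (thetaModulus t) * JTheta u (thetaModulus t) ^ 2 := by
  have hK := EllK_thetaModulus ht
  have p3 := thetaThree_pos ht
  have hKp := EllK_pos (thetaModulus_sq_lt_one ht)
  obtain ⟨d3, d2⟩ := thetaThree_deriv_two_mul ht
  have hk' := sqrt_one_sub_thetaModulus_sq ht
  have i1 : -(π / EllK (thetaModulus t)) ^ 2 / 2 * (4 * thetaMoment (2 * t)) =
      thetaThree (2 * t) * (√(1 - thetaModulus t ^ 2) -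
        EllE (thetaModulus t) / EllK (thetaModulus t)) := by
    have : -(π / EllK (thetaModulus t)) ^ 2 / 2 * (4 * thetaMoment (2 * t)) =
        2 * π / EllK (thetaModulus t) ^ 2 * (-π * thetaMoment (2 * t)) := by ring
    rw [this, d3, hk', hK]
    field_simp
    ring
  have i2 : (π / EllK (thetaModulus t)) ^ 2 / 2 *
      (thetaMoment (t / 2) - 4 * thetaMoment (2 * t)) =
      thetaTwo (2 * t) * (√(1 - thetaModulus t ^ 2) +
        EllE (thetaModulus t) / EllK (thetaModulus t)) := by
    have : (π / EllK (thetaModulus t)) ^ 2 / 2 *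
        (thetaMoment (t / 2) - 4 * thetaMoment (2 * t)) = -(2 * π / EllK (thetaModulus t) ^ 2 *
        (-π * (thetaMoment (2 * t / 4) / 4 - thetaMoment (2 * t)))) := by
      rw [show 2 * t / 4 = t / 2 by ring]
      ring
    rw [this, d2, hk', hK]
    field_simp
    ring
  rw [← Complex.ofReal_inj]
  push_cast
  rw [JTheta_thetaModulus u ht, JTheta1_thetaModulus u ht, deriv_JTheta_thetaModulus u ht,
    deriv_deriv_JTheta_thetaModulus u ht]
  set x := u / (2 * EllK (thetaModulus t))
  have q1 := gaussSeries_sq x ht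
  have q2 := gaussSeries_sq (x + 1 / 2) ht
  have w := gaussSeries_wronskian (x + 1 / 2) ht
  have e1 : gaussSeries 0 (2 * (x + 1 / 2)) (2 * t) = gaussSeries 0 (2 * x) (2 * t) := by
    rw [← gaussSeries_add_one 0 (2 * x)]
    ring_nf
  have e2 : gaussSeries 0 (x + 1 / 2) (t / 2) =
      2 * gaussSeries 0 (2 * x) (2 * t) - gaussSeries 0 x (t / 2) := by
    rw [gaussSeries_add_half x (half_pos ht), show 4 * (t / 2) = 2 * t by ring]
  rw [e1, e2] at q2 w
  have c1 := congrArg (fun r : ℝ => (r : ℂ)) i1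
  have c2 := congrArg (fun r : ℝ => (r : ℂ)) i2
  push_cast at c1 c2
  rw [q1, q2]
  linear_combination -(π / EllK (thetaModulus t) : ℂ) ^ 2 / 2 * w +
    gaussSeries 0 (2 * x) (2 * t) * c1 +
    (gaussSeries 0 x (t / 2) - gaussSeries 0 (2 * x) (2 * t)) * c2 -
    (π / EllK (thetaModulus t) : ℂ) ^ 2 * gaussSeries 1 (x + 1 / 2) t ^ 2 * Complex.I_sq

lemma JTheta_mul_dn_sq_add_zn_sq (u : ℝ) {t : ℝ} (ht : 0 < t) :
    JTheta u (thetaModulus t) * (dn u (thetaModulus t) ^ 2 + zn u (thetaModulus t) ^ 2 -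
      EllE (thetaModulus t) / EllK (thetaModulus t)) =
    deriv (deriv (fun v => JTheta v (thetaModulus t))) u := by
  have h0 := JTheta_ne_zero u ht
  have h := JTheta_mul_deriv_deriv_sub u ht
  rw [dn, zn, div_pow, div_pow, mul_pow, Real.sq_sqrt (Real.sqrt_nonneg _)]
  refine mul_left_cancel₀ h0 ?_
  have e : JTheta u (thetaModulus t) * (JTheta u (thetaModulus t) *
      (√(1 - thetaModulus t ^ 2) * JTheta1 u (thetaModulus t) ^ 2 / JTheta u (thetaModulus t) ^ 2 +
      deriv (fun v => JTheta v (thetaModulus t)) u ^ 2 / JTheta u (thetaModulus t) ^ 2 -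
      EllE (thetaModulus t) / EllK (thetaModulus t))) =
      √(1 - thetaModulus t ^ 2) * JTheta1 u (thetaModulus t) ^ 2 +
      deriv (fun v => JTheta v (thetaModulus t)) u ^ 2 -
      EllE (thetaModulus t) / EllK (thetaModulus t) * JTheta u (thetaModulus t) ^ 2 := by
    field_simp
  rw [e]
  linear_combination -h

lemma JTheta_mul_EllK_hasDerivAt (lam : ℝ) {t : ℝ} (ht : 0 < t) :
    HasDerivAt (fun k => JTheta (lam * EllK k) k)
      (-(1 / (2 * thetaModulus t * √(1 - thetaModulus t ^ 2) ^ 2)) *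
        deriv (deriv (fun u => JTheta u (thetaModulus t))) (lam * EllK (thetaModulus t)))
      (thetaModulus t) := by
  have hκ := thetaModulus_pos ht
  have hκ1 := thetaModulus_sq_lt_one ht
  have h3 := thetaThree_pos ht
  have h4 := thetaFour_pos ht
  have hlt : thetaModulus t < 1 := by nlinarith
  have hx : ∀ s, 0 < s → lam * EllK (thetaModulus s) / (2 * EllK (thetaModulus s)) + 1 / 2 =
      lam / 2 + 1 / 2 := fun s hs => by
    have := EllK_pos (thetaModulus_sq_lt_one hs)
    field_simp
  have hT := EllK'_div_EllK_hasDerivAt ht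
  have hg := gaussSeries_hasDerivAt_snd 0 (lam / 2 + 1 / 2) ht
  rw [← EllK'_thetaModulus_div ht] at hg
  have h := (hg.scomp (thetaModulus t) hT).congr_of_eventuallyEq
    (f₁ := fun k => (JTheta (lam * EllK k) k : ℂ)) (by
      filter_upwards [Ioo_mem_nhds hκ hlt] with y hy
      obtain ⟨s, hs, rfl⟩ := exists_thetaModulus_eq hy
      simp only [Function.comp]
      rw [JTheta_thetaModulus _ hs, hx s hs, EllK'_thetaModulus_div hs])
  obtain ⟨h1, h2⟩ := h.of_ofReal
  refine h2.congr_deriv ?_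
  rw [← Complex.ofReal_inj, ← h1, EllK'_thetaModulus_div ht, Complex.real_smul]
  push_cast
  rw [deriv_deriv_JTheta_thetaModulus _ ht, hx t ht, sqrt_one_sub_thetaModulus_sq ht,
    EllK_thetaModulus ht]
  have c3 : (thetaThree t : ℂ) ≠ 0 := by exact_mod_cast h3.ne'
  have c4 : (thetaFour t : ℂ) ≠ 0 := by exact_mod_cast h4.ne'
  have cκ : (thetaModulus t : ℂ) ≠ 0 := by exact_mod_cast hκ.ne'
  have cπ : (π : ℂ) ≠ 0 := by exact_mod_cast pi_ne_zero
  push_cast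
  field_simp

theorem stmt_19 (lam : ℝ) :
    ∀ k ∈ Set.Ioo (0:ℝ) 1,
      HasDerivAt (fun k => JTheta (lam * EllK k) k)
        (-(1 / (2 * k * Real.sqrt (1 - k^2) ^ 2)) * JTheta (lam * EllK k) k *
          (dn (lam * EllK k) k ^ 2 + zn (lam * EllK k) k ^ 2 - EllE k / EllK k)) k ∧
      -(1 / (2 * k * Real.sqrt (1 - k^2) ^ 2)) * JTheta (lam * EllK k) k *
          (dn (lam * EllK k) k ^ 2 + zn (lam * EllK k) k ^ 2 - EllE k / EllK k) =
        -(1 / (2 * k * Real.sqrt (1 - k^2) ^ 2)) *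
          deriv (deriv (fun u => JTheta u k)) (lam * EllK k) := by
  intro k hk
  obtain ⟨t, ht, rfl⟩ := exists_thetaModulus_eq hk
  rw [mul_assoc, JTheta_mul_dn_sq_add_zn_sq _ ht]
  exact ⟨JTheta_mul_EllK_hasDerivAt lam ht, rfl⟩
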